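/- arXiv:2205.04499 — 2 statements merged into one kernel-verified Lean document; each statement's English description precedes it below -/
import Mathlib

section
/- Let k be a field, V a finite-dimensional k-vector space, and N : V → V a nilpotent endomorphism. Then there exists a unique increasing filtration M_• of V (indexed by integers) such that N(M_i) ⊆ M_{i-2} for all i, and for each k ≥ 0 the map N^k induces an isomorphism gr_k M_• → gr_{-k} M_•. -/
section MonodromyFiltration

variable {k V : Type*} [Field k] [AddCommGroup V] [Module k V]

/-- The sum of the subspaces `N ^ b (ker N ^ (a + b + 1)) = ker N ^ (a + 1) ∩ im N ^ b` over
all natural numbers `a`, `b` with `a - b ≤ i`. -/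
def monodromyFiltration (N : V →ₗ[k] V) (i : ℤ) : Submodule k V :=
  ⨆ (a : ℕ) (b : ℕ) (_ : (a : ℤ) - b ≤ i), (LinearMap.ker (N ^ (a + b + 1))).map (N ^ b)

namespace monodromyFiltration

variable (N : V →ₗ[k] V)

theorem pow_apply_mem {a b : ℕ} {i : ℤ} (hab : (a : ℤ) - b ≤ i) {x : V}
    (hx : (N ^ (a + b + 1)) x = 0) : (N ^ b) x ∈ monodromyFiltration N i := by
  have h : (LinearMap.ker (N ^ (a + b + 1))).map (N ^ b) ≤ monodromyFiltration N i :=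
    le_iSup_of_le a (le_iSup_of_le b (le_iSup_of_le hab le_rfl))
  exact h (Submodule.mem_map_of_mem hx)

theorem le_of_forall {i : ℤ} {P : Submodule k V}
    (h : ∀ (a b : ℕ) (x : V), (a : ℤ) - b ≤ i → (N ^ (a + b + 1)) x = 0 → (N ^ b) x ∈ P) :
    monodromyFiltration N i ≤ P := by
  refine iSup_le fun a => iSup_le fun b => iSup_le fun hab => ?_
  rintro _ ⟨x, hx, rfl⟩
  exact h a b x hab hx

theorem monotone : Monotone (monodromyFiltration N) := fun _ _ hij =>
  le_of_forall N fun _ _ _ hab hx => pow_apply_mem N (hab.trans hij) hx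

theorem exists_eq_bot (hN : IsNilpotent N) : ∃ i, monodromyFiltration N i = ⊥ := by
  obtain ⟨m, hm⟩ := hN
  refine ⟨-m, le_bot_iff.mp (le_of_forall N fun a b x hab _ => ?_)⟩
  simp [pow_eq_zero_of_le (show m ≤ b by omega) hm]

theorem exists_eq_top (hN : IsNilpotent N) : ∃ i, monodromyFiltration N i = ⊤ := by
  obtain ⟨m, hm⟩ := hN
  refine ⟨m, eq_top_iff.mpr fun x _ => ?_⟩
  exact pow_apply_mem N (a := m) (b := 0) (by simp) (by simp [pow_succ', hm])

theorem map_le (i : ℤ) : (monodromyFiltration N i).map N ≤ monodromyFiltration N (i - 2) := by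
  rw [Submodule.map_le_iff_le_comap]
  refine le_of_forall N fun a b x hab hx => ?_
  rw [Submodule.mem_comap, ← Module.End.mul_apply, ← pow_succ']
  rcases a with _ | a
  · rw [zero_add] at hx
    simp [hx]
  · exact pow_apply_mem N (a := a) (by push_cast at hab ⊢; omega)
      (by rwa [show a + (b + 1) + 1 = a + 1 + b + 1 by omega])

theorem neg_le_map_pow (j : ℕ) :
    monodromyFiltration N (-(j : ℤ)) ≤ (monodromyFiltration N j).map (N ^ j) := by
  refine le_of_forall N fun a b x hab hx => ?_
  obtain ⟨c, rfl⟩ : ∃ c, b = j + c := ⟨b - j, by omega⟩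
  rw [pow_add, Module.End.mul_apply]
  refine Submodule.mem_map_of_mem (pow_apply_mem N (a := a + j) ?_ ?_)
  · push_cast at hab ⊢
    omega
  · rwa [show a + j + c + 1 = a + (j + c) + 1 by omega]

theorem mem_of_pow_apply_mem {j : ℕ} {y : V}
    (hy : (N ^ j) y ∈ monodromyFiltration N (-(j : ℤ) - 1)) :
    y ∈ monodromyFiltration N ((j : ℤ) - 1) := by
  rw [show -(j : ℤ) - 1 = -((j + 1 : ℕ) : ℤ) by push_cast; ring] at hy
  obtain ⟨z, hz, hzy⟩ := neg_le_map_pow N (j + 1) hy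
  have hNz : N z ∈ monodromyFiltration N ((j : ℤ) - 1) := by
    have := map_le N _ (Submodule.mem_map_of_mem hz)
    rwa [show ((j + 1 : ℕ) : ℤ) - 2 = (j : ℤ) - 1 by push_cast; ring] at this
  have hker : (N ^ j) (y - N z) = 0 := by
    rw [map_sub, ← hzy, pow_succ, Module.End.mul_apply, sub_self]
  have hsub : y - N z ∈ monodromyFiltration N ((j : ℤ) - 1) := by
    rcases j with _ | j
    · rw [pow_zero, Module.End.one_apply] at hker
      simp [hker]
    · exact pow_apply_mem N (a := j) (b := 0) (by simp) hker
  simpa using add_mem hsub hNz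

end monodromyFiltration

/-- A finite filtration `M` with `N (M i) ⊆ M (i - 2)` on which every `N ^ j` induces an
isomorphism `gr_j M → gr_{-j} M`. -/
structure IsMonodromyFiltration (N : V →ₗ[k] V) (M : ℤ → Submodule k V) : Prop where
  monotone : Monotone M
  exists_eq_bot : ∃ a, M a = ⊥
  exists_eq_top : ∃ b, M b = ⊤
  map_le : ∀ i, (M i).map N ≤ M (i - 2)
  gr_surjective : ∀ (j : ℕ), ∀ x ∈ M (-(j : ℤ)), ∃ y ∈ M (j : ℤ),
    x - (N ^ j) y ∈ M (-(j : ℤ) - 1)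
  gr_injective : ∀ (j : ℕ), ∀ y ∈ M (j : ℤ), (N ^ j) y ∈ M (-(j : ℤ) - 1) → y ∈ M ((j : ℤ) - 1)

theorem isMonodromyFiltration_monodromyFiltration {N : V →ₗ[k] V} (hN : IsNilpotent N) :
    IsMonodromyFiltration N (monodromyFiltration N) where
  monotone := monodromyFiltration.monotone N
  exists_eq_bot := monodromyFiltration.exists_eq_bot N hN
  exists_eq_top := monodromyFiltration.exists_eq_top N hN
  map_le := monodromyFiltration.map_le N
  gr_surjective j x hx := by
    obtain ⟨y, hy, rfl⟩ := monodromyFiltration.neg_le_map_pow N j hx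
    exact ⟨y, hy, by simp⟩
  gr_injective _ _ _ h := monodromyFiltration.mem_of_pow_apply_mem N h

namespace IsMonodromyFiltration

variable {N : V →ₗ[k] V} {M M' : ℤ → Submodule k V}

theorem pow_apply_mem (hM : IsMonodromyFiltration N M) (s : ℕ) {i : ℤ} {x : V} (hx : x ∈ M i) :
    (N ^ s) x ∈ M (i - 2 * s) := by
  induction s with
  | zero => simpa using hx
  | succ s ih =>
    rw [pow_succ', Module.End.mul_apply]
    have := hM.map_le _ (Submodule.mem_map_of_mem ih)
    rwa [show i - 2 * (s : ℤ) - 2 = i - 2 * ((s + 1 : ℕ) : ℤ) by push_cast; ring] at this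

theorem neg_eq_map_pow (hM : IsMonodromyFiltration N M) (j : ℕ) :
    M (-(j : ℤ)) = (M j).map (N ^ j) := by
  obtain ⟨a, ha⟩ := hM.exists_eq_bot
  have key : ∀ t s : ℕ, -(j : ℤ) - s - t ≤ a → M (-(j : ℤ) - s) ≤ (M j).map (N ^ j) := by
    intro t
    induction t with
    | zero =>
      intro s hs
      exact (hM.monotone (by simpa using hs)).trans (ha.le.trans bot_le)
    | succ t ih =>
      intro s hs x hx
      obtain ⟨y, hy, hxy⟩ := hM.gr_surjective (j + s) x
        (by rwa [show -((j + s : ℕ) : ℤ) = -(j : ℤ) - s by push_cast; ring])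
      have hrest : x - (N ^ (j + s)) y ∈ (M j).map (N ^ j) := by
        refine ih (s + 1) (by push_cast at hs ⊢; omega) ?_
        rwa [show -(j : ℤ) - ((s + 1 : ℕ) : ℤ) = -((j + s : ℕ) : ℤ) - 1 by push_cast; ring]
      have hmain : (N ^ (j + s)) y ∈ (M j).map (N ^ j) := by
        rw [pow_add, Module.End.mul_apply]
        refine Submodule.mem_map_of_mem (hM.monotone ?_ (hM.pow_apply_mem s hy))
        push_cast
        omega
      simpa using add_mem hrest hmain
  apply le_antisymm
  · simpa using key (-(j : ℤ) - a).toNat 0 (by push_cast; omega)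
  · rintro _ ⟨y, hy, rfl⟩
    simpa [two_mul] using hM.pow_apply_mem j hy

theorem eq_comap_pow (hM : IsMonodromyFiltration N M) (n : ℕ) :
    M n = (M (-((n + 2 : ℕ) : ℤ))).comap (N ^ (n + 1)) := by
  apply le_antisymm
  · intro x hx
    have := hM.pow_apply_mem (n + 1) hx
    rwa [show (n : ℤ) - 2 * ((n + 1 : ℕ) : ℤ) = -((n + 2 : ℕ) : ℤ) by push_cast; ring] at this
  · intro x hx
    have descend : ∀ s : ℕ, x ∈ M (n + s) → x ∈ M n := by
      intro s
      induction s with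
      | zero => simp
      | succ s ih =>
        intro hs
        have hpow : (N ^ (n + 1 + s)) x ∈ M (-((n + 1 + s : ℕ) : ℤ) - 1) := by
          rw [add_comm (n + 1) s, pow_add, Module.End.mul_apply]
          refine hM.monotone ?_ (hM.pow_apply_mem s hx)
          push_cast
          omega
        have := hM.gr_injective (n + 1 + s) x
          (by rwa [show ((n + 1 + s : ℕ) : ℤ) = n + ((s + 1 : ℕ) : ℤ) by push_cast; ring]) hpow
        apply ih
        rwa [show ((n + 1 + s : ℕ) : ℤ) - 1 = n + s by push_cast; ring] at this
    obtain ⟨b, hb⟩ := hM.exists_eq_top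
    apply descend (b - n).toNat
    exact hM.monotone (show b ≤ _ by omega) (hb ▸ Submodule.mem_top)

protected theorem unique (hM : IsMonodromyFiltration N M) (hM' : IsMonodromyFiltration N M') :
    M = M' := by
  obtain ⟨b, hb⟩ := hM.exists_eq_top
  obtain ⟨b', hb'⟩ := hM'.exists_eq_top
  have key : ∀ s n : ℕ, max b b' ≤ n + s → M n = M' n := by
    intro s
    induction s with
    | zero =>
      intro n hn
      rw [Nat.cast_zero, add_zero, max_le_iff] at hn
      rw [eq_top_iff.mpr (hb.ge.trans (hM.monotone hn.1)),
        eq_top_iff.mpr (hb'.ge.trans (hM'.monotone hn.2))]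
    | succ s ih =>
      intro n hn
      rw [hM.eq_comap_pow, hM'.eq_comap_pow, hM.neg_eq_map_pow, hM'.neg_eq_map_pow,
        ih (n + 2) (by push_cast at hn ⊢; omega)]
  have hnat (n : ℕ) : M n = M' n := key (max b b').toNat n (by omega)
  funext i
  obtain ⟨n, rfl | rfl⟩ := i.eq_nat_or_neg
  · exact hnat n
  · rw [hM.neg_eq_map_pow, hM'.neg_eq_map_pow, hnat]

end IsMonodromyFiltration

end MonodromyFiltration

/-- **Deligne's monodromy filtration.** Let `k` be a field, `V` a finite-dimensional
`k`-vector space, and `N : V → V` a nilpotent endomorphism. Then there exists a unique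
increasing filtration `M_•` of `V` (indexed by `ℤ`, exhaustive and separated) such that
`N(M i) ⊆ M (i-2)` for all `i`, and for each `j ≥ 0` the map `N^j` induces an isomorphism
`gr_j M → gr_{-j} M` (phrased elementwise: surjectivity and injectivity on graded pieces). -/
theorem monodromy_filtration_exists_unique
    (k : Type*) [Field k] (V : Type*) [AddCommGroup V] [Module k V]
    [FiniteDimensional k V]
    (N : V →ₗ[k] V) (hN : IsNilpotent N) :
    ∃! M : ℤ → Submodule k V,
      Monotone M ∧
      (∃ a : ℤ, M a = ⊥) ∧ (∃ b : ℤ, M b = ⊤) ∧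
      (∀ i : ℤ, (M i).map N ≤ M (i - 2)) ∧
      (∀ j : ℕ,
        (∀ x ∈ M (-(j : ℤ)), ∃ y ∈ M (j : ℤ), x - (N ^ j) y ∈ M (-(j : ℤ) - 1)) ∧
        (∀ y ∈ M (j : ℤ), (N ^ j) y ∈ M (-(j : ℤ) - 1) → y ∈ M ((j : ℤ) - 1))) := by
  have h := isMonodromyFiltration_monodromyFiltration hN
  refine ⟨monodromyFiltration N, ⟨h.monotone, h.exists_eq_bot, h.exists_eq_top, h.map_le,
    fun j => ⟨h.gr_surjective j, h.gr_injective j⟩⟩, ?_⟩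
  rintro M ⟨hmono, hbot, htop, hmap, hgr⟩
  exact IsMonodromyFiltration.unique
    ⟨hmono, hbot, htop, hmap, fun j => (hgr j).1, fun j => (hgr j).2⟩ h
end

section
/- Let 𝔤 be a finite-dimensional semisimple Lie algebra over an algebraically closed field of characteristic zero, and let 𝔥 ⊆ 𝔤 be a proper semisimple Lie subalgebra containing a regular nilpotent element E of 𝔤. Then rank(𝔥) < rank(𝔤). -/
open Module LinearMap in
/-- The kernel of a linear map between finite-dimensional spaces can only shrink along a pencil,
away from finitely many parameters. -/
theorem LinearMap.finite_setOf_finrank_ker_lt_finrank_ker_smul_add {K V W : Type*} [Field K]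
    [AddCommGroup V] [Module K V] [AddCommGroup W] [Module K W] [FiniteDimensional K V]
    (f g : V →ₗ[K] W) :
    {t : K | finrank K (ker f) < finrank K (ker (t • g + f))}.Finite := by
  obtain ⟨C, hC⟩ := (ker f).exists_isCompl
  have hinj : ker (f.domRestrict C) = ⊥ := by
    rw [ker_eq_bot']
    intro c hc
    have : (c : V) ∈ ker f ⊓ C := ⟨by simpa using hc, c.2⟩
    rw [hC.inf_eq_bot] at this
    simpa using this
  obtain ⟨P, hP⟩ := (f.domRestrict C).exists_leftInverse_of_injective hinj
  set B : End K C := P ∘ₗ g.domRestrict C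
  have hfin : {t : K | B.HasEigenvalue (-t⁻¹)}.Finite :=
    (Module.End.finite_hasEigenvalue B).preimage fun a _ b _ hab ↦ by simpa using hab
  refine (hfin.union (Set.finite_singleton 0)).subset fun t ht ↦ ?_
  by_contra hcon
  simp only [Set.mem_union, Set.mem_ofPred_eq, Set.mem_singleton_iff, not_or] at hcon
  obtain ⟨ht₁, ht₀⟩ := hcon
  have hdisj : Disjoint (ker (t • g + f)) C := by
    rw [Submodule.disjoint_def]
    intro c hc hcC
    by_contra hc0
    refine ht₁ (Module.End.hasEigenvalue_of_hasEigenvector (x := ⟨c, hcC⟩) ⟨?_, by simpa using hc0⟩)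
    rw [Module.End.mem_eigenspace_iff]
    have h₁ : P (f c) = ⟨c, hcC⟩ := LinearMap.congr_fun hP ⟨c, hcC⟩
    have h₂ : t • P (g c) + P (f c) = 0 := by
      rw [← map_smul, ← map_add]
      simpa using congrArg P hc
    have h₃ : B ⟨c, hcC⟩ = P (g c) := rfl
    rw [h₃, neg_smul, eq_neg_iff_add_eq_zero, ← smul_right_injective _ ht₀ |>.eq_iff]
    simpa [smul_smul, ht₀, h₁] using h₂
  have h₁ := Submodule.finrank_add_finrank_le_of_disjoint hdisj
  have h₂ := Submodule.finrank_add_eq_of_isCompl hC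
  simp only [Set.mem_ofPred_eq] at ht
  lia

open Polynomial in
/-- On a line through a regular element, all but finitely many elements are regular. -/
theorem LieModule.finite_setOf_not_isRegular_smul_add {K L M : Type*} [Field K]
    [LieRing L] [LieAlgebra K L] [FiniteDimensional K L]
    [AddCommGroup M] [Module K M] [LieRingModule L M] [LieModule K L M] [FiniteDimensional K M]
    {x y : L} {t₀ : K} (h : LieModule.IsRegular K M (t₀ • y + x)) :
    {t : K | ¬ LieModule.IsRegular K M (t • y + x)}.Finite := by
  classical
  set b := Module.finBasis K L
  obtain ⟨q, hq⟩ : ∃ q : MvPolynomial _ K, ∀ z,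
      LieModule.IsRegular K M z ↔ MvPolynomial.eval (b.repr z) q ≠ 0 :=
    ⟨_, fun z ↦ LieModule.isRegular_iff_coeff_polyCharpoly_rank_ne_zero K M b z⟩
  set p : K[X] := MvPolynomial.aeval (fun i ↦ C (b.repr y i) * X + C (b.repr x i)) q
  have hp (t : K) : LieModule.IsRegular K M (t • y + x) ↔ p.eval t ≠ 0 := by
    rw [hq]
    have aux : (fun i ↦ b.repr y i * t + b.repr x i) = b.repr (t • y + x) := by
      ext i
      simp [mul_comm t]
    rw [← coe_evalRingHom, ← coe_aeval_eq_evalRingHom, RingHom.coe_coe, ← AlgHom.comp_apply,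
      MvPolynomial.comp_aeval]
    simp [aux]
  have hp₀ : p ≠ 0 := by
    intro h₀
    exact (hp t₀).mp h (by simp [h₀])
  refine (Polynomial.finite_setOfPred_isRoot hp₀).subset fun t ht ↦ ?_
  simpa [hp] using ht

open LieAlgebra LieSubalgebra Module in
theorem LieAlgebra.isCartanSubalgebra_engel_of_isRegular {K L : Type*} [Field K] [Infinite K]
    [LieRing L] [LieAlgebra K L] [FiniteDimensional K L] {x : L} (hx : IsRegular K x) :
    (engel K x).IsCartanSubalgebra := by
  refine ⟨isNilpotent_of_forall_le_engel _ fun y hy ↦ ?_, normalizer_engel _ _⟩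
  set Ex : {engel K z | z ∈ engel K x} := ⟨engel K x, x, self_mem_engel _ _, rfl⟩
  suffices IsBot Ex from @this ⟨engel K y, y, hy, rfl⟩
  have hcard : (finrank K L : Cardinal) ≤ Cardinal.mk K :=
    Cardinal.natCast_le_aleph0.trans <| Cardinal.infinite_iff.mp ‹Infinite K›
  apply engel_isBot_of_isMin hcard (engel K x) Ex le_rfl
  rintro ⟨_, y, hy, rfl⟩ hyx
  suffices engel K y = engel K x from this.ge
  apply LieSubalgebra.toSubmodule_injective
  refine Submodule.eq_of_le_of_finrank_le hyx ?_
  have := (isRegular_iff_finrank_engel_eq_rank K x).mp hx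
  exact this.trans_le (rank_le_finrank_engel K y)

open LieAlgebra LieSubalgebra Module in
theorem LieAlgebra.finrank_ker_ad_eq_rank_of_isRegular {K L : Type*} [Field K] [IsAlgClosed K]
    [LieRing L] [LieAlgebra K L] [FiniteDimensional K L] [IsKilling K L]
    {x : L} (hx : IsRegular K x) :
    finrank K (LinearMap.ker (ad K L x)) = rank K L := by
  have := IsAlgClosed.instInfinite (K := K)
  have := isCartanSubalgebra_engel_of_isRegular hx
  have hss := IsKilling.isSemisimple_ad_of_mem_isCartanSubalgebra (self_mem_engel K x)
  have h := hss.isFinitelySemisimple.maxGenEigenspace_eq_eigenspace 0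
  rw [End.eigenspace_zero] at h
  rw [← (isRegular_iff_finrank_engel_eq_rank K x).mp hx, ← h]
  rfl

open LieAlgebra Module in
/-- In a Lie algebra with nondegenerate Killing form, every centralizer has dimension at least the
rank. -/
theorem LieAlgebra.rank_le_finrank_ker_ad {K L : Type*} [Field K] [IsAlgClosed K]
    [LieRing L] [LieAlgebra K L] [FiniteDimensional K L] [IsKilling K L] (x : L) :
    rank K L ≤ finrank K (LinearMap.ker (ad K L x)) := by
  have := IsAlgClosed.instInfinite (K := K)
  obtain ⟨z, hz⟩ := exists_isRegular K L
  have h₁ := LieModule.finite_setOf_not_isRegular_smul_add (K := K) (M := L) (x := x) (y := z - x)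
    (t₀ := 1) (by simpa using hz)
  have h₂ := (ad K L x).finite_setOf_finrank_ker_lt_finrank_ker_smul_add (ad K L (z - x))
  obtain ⟨t, ht⟩ := (h₁.union h₂).exists_notMem
  simp only [Set.mem_union, Set.mem_ofPred_eq, not_or, not_not, not_lt] at ht
  rw [← finrank_ker_ad_eq_rank_of_isRegular ht.1]
  rw [map_add, map_smul]
  exact ht.2

open LieAlgebra Module in
/-- The trace form of a Lie subalgebra with trivial radical, acting on the ambient algebra,
is nondegenerate. -/
theorem LieSubalgebra.ker_traceForm_eq_bot {K L : Type*} [Field K] [CharZero K]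
    [LieRing L] [LieAlgebra K L] [FiniteDimensional K L]
    (H : LieSubalgebra K L) [HasTrivialRadical K H] :
    LinearMap.ker (LieModule.traceForm K H L) = ⊥ := by
  set J : LieIdeal K H := InvariantForm.orthogonal (LieModule.traceForm K H L)
    (LieModule.traceForm_lieInvariant K H L) ⊤
  have hJ (x : H) : x ∈ J ↔ x ∈ LinearMap.ker (LieModule.traceForm K H L) := by
    simp [J, InvariantForm.mem_orthogonal, LinearMap.ext_iff, LieModule.traceForm_comm K H L x]
  have tf : LieModule.traceForm K J L = 0 := by
    ext ⟨x, hx⟩ ⟨y, hy⟩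
    exact LinearMap.congr_fun ((hJ x).mp hx) y
  have nilp : LieModule.IsNilpotent (derivedSeries K J 1) L :=
    LieModule.isNilpotent_derivedSeries_of_traceForm_eq_zero tf
  set D : LieIdeal K H := ⁅J, J⁆
  have ring_nilp : LieRing.IsNilpotent D := by
    rw [LieAlgebra.isNilpotent_iff_forall (R := K)]
    rintro ⟨x, hx⟩
    apply LieSubalgebra.isNilpotent_ad_of_isNilpotent_ad (D : LieSubalgebra K H) (x := ⟨x, hx⟩)
    apply LieSubalgebra.isNilpotent_ad_of_isNilpotent_ad H (x := x)
    refine (LieModule.isNilpotent_iff_forall' (R := K)).mp nilp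
      ⟨⟨x, LieSubmodule.lie_le_left J J hx⟩, ?_⟩
    rwa [LieIdeal.derivedSeries_eq_derivedSeriesOfIdeal_comap, LieIdeal.mem_comap]
  have hD : D = ⊥ := HasTrivialRadical.eq_bot_of_isSolvable D
  have hab : IsLieAbelian J := LieSubmodule.lie_abelian_iff_lie_self_eq_bot J |>.mpr hD
  have hJ₀ : J = ⊥ := HasTrivialRadical.eq_bot_of_isSolvable J
  ext x
  rw [← hJ, hJ₀]
  simp

open LieAlgebra Module in
/-- A Lie subalgebra with trivial radical that contains the centralizer of one of its ad-nilpotent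
elements is the whole algebra. -/
theorem LieSubalgebra.eq_top_of_ker_ad_le {K L : Type*} [Field K] [CharZero K]
    [LieRing L] [LieAlgebra K L] [FiniteDimensional K L]
    (H : LieSubalgebra K L) [HasTrivialRadical K H] {e : L} (he : e ∈ H)
    (hnil : IsNilpotent (ad K L e)) (hker : LinearMap.ker (ad K L e) ≤ H.toSubmodule) :
    H = ⊤ := by
  set M := (killingForm K L).orthogonal H.toSubmodule
  have hrefl : (killingForm K L).IsRefl := (LieModule.traceForm_isSymm K L L).isRefl
  have hdisj : Disjoint H.toSubmodule M := by
    rw [Submodule.disjoint_def]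
    intro x hx hxM
    have : (⟨x, hx⟩ : H) ∈ LinearMap.ker (LieModule.traceForm K H L) := by
      ext y
      exact hrefl _ _ (hxM y y.2)
    rw [H.ker_traceForm_eq_bot] at this
    exact congrArg Subtype.val ((Submodule.mem_bot K).mp this)
  have hmaps (x : L) (hx : x ∈ M) : ad K L e x ∈ M := by
    intro y hy
    have := hx _ (H.lie_mem hy he)
    exact (LieModule.traceForm_apply_lie_apply K L L y e x).symm.trans this
  have hM : M = ⊥ := by
    rw [Submodule.eq_bot_iff]
    obtain ⟨n, hn⟩ := hnil
    have key (m : ℕ) : ∀ x ∈ M, (ad K L e ^ m) x = 0 → x = 0 := by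
      induction m with
      | zero => simp
      | succ m ih =>
        intro x hx h
        rw [pow_succ, End.mul_apply] at h
        exact Submodule.disjoint_def.mp hdisj x (hker (ih _ (hmaps x hx) h)) hx
    exact fun x hx ↦ key n x hx (by simp [hn])
  have := ((LinearMap.BilinForm.isCompl_orthogonal_iff_disjoint hrefl).mpr hdisj).sup_eq_top
  change H.toSubmodule ⊔ M = ⊤ at this
  rw [hM, sup_bot_eq] at this
  rwa [← LieSubalgebra.toSubmodule_inj]

/-- Let `𝔤` be a finite-dimensional semisimple Lie algebra over an algebraically closed field
of characteristic zero, and `𝔥 ⊆ 𝔤` a proper semisimple Lie subalgebra containing a regular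
nilpotent element `E` of `𝔤` (regular meaning the centralizer of `E` has dimension equal to
the rank of `𝔤`). Then `rank 𝔥 < rank 𝔤`. -/
theorem rank_lt_of_proper_semisimple_subalgebra_contains_regular_nilpotent
    (k : Type*) [Field k] [IsAlgClosed k] [CharZero k]
    (L : Type*) [LieRing L] [LieAlgebra k L] [FiniteDimensional k L]
    [LieAlgebra.IsSemisimple k L]
    (H : LieSubalgebra k L) (hH : H ≠ ⊤)
    [LieAlgebra.IsSemisimple k H]
    (E : L) (hE : E ∈ H)
    (hnil : IsNilpotent ((LieAlgebra.ad k L) E))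
    (hreg : Module.finrank k (LinearMap.ker ((LieAlgebra.ad k L) E)) = LieAlgebra.rank k L) :
    LieAlgebra.rank k H < LieAlgebra.rank k L := by

  by_contra! hrank
  let ι : LinearMap.ker (LieAlgebra.ad k H ⟨E, hE⟩) →ₗ[k] L :=
    H.toSubmodule.subtype ∘ₗ (LinearMap.ker (LieAlgebra.ad k H ⟨E, hE⟩)).subtype
  have hι : Function.Injective ι :=
    H.toSubmodule.injective_subtype.comp (Submodule.injective_subtype _)
  have hle : LinearMap.range ι ≤ LinearMap.ker (LieAlgebra.ad k L E) := by
    rintro _ ⟨⟨x, hx⟩, rfl⟩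
    exact congrArg Subtype.val (LinearMap.mem_ker.mp hx)
  have heq : LinearMap.range ι = LinearMap.ker (LieAlgebra.ad k L E) := by
    refine Submodule.eq_of_le_of_finrank_le hle ?_
    rw [hreg, LinearMap.finrank_range_of_inj hι]
    exact hrank.trans (LieAlgebra.rank_le_finrank_ker_ad _)
  refine hH (H.eq_top_of_ker_ad_le hE hnil ?_)
  rw [← heq]
  rintro _ ⟨x, rfl⟩
  exact x.1.2
end
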